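/- Let C : Ordinal.{u} → Set Ordinal.{u} be an Ord-indexed sequence of classes of ordinals such that each C i is unbounded (with respect to <) and every class occurring in the sequence occurs unboundedly often, i.e. for every i the class {j | C j = C i} is unbounded. Then there exist classes D, E : Set Ordinal.{u} such that for every i, each of the three classes C i ∩ (D ∩ E), C i ∩ (D \ E) and C i ∩ (E \ D) is unbounded. (This is the combinatorial content of the recursive construction of the classes D and E in the proof of Theorem 6.5 of the paper, where each of D ∩ E, D \ E and E \ D is arranged to have proper-class-sized intersection with each proper class appearing unboundedly often in the enumeration.) -/

import Mathlib

universe u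

/-- The increasing choice sequence of a family `A` of classes of ordinals: the value at `o` is the
least element of `A o` above all earlier values. -/
noncomputable def increasingChoice (A : Ordinal.{u} → Set Ordinal.{u}) (o : Ordinal.{u}) :
    Ordinal.{u} :=
  sInf {x | x ∈ A o ∧ ∀ k, (_ : k < o) → increasingChoice A k < x}
termination_by o

theorem increasingChoice_spec {A : Ordinal.{u} → Set Ordinal.{u}}
    (hA : ∀ i, Set.Unbounded (· < ·) (A i)) (o : Ordinal.{u}) :
    increasingChoice A o ∈ A o ∧ ∀ k < o, increasingChoice A k < increasingChoice A o := by
  have hne : {x | x ∈ A o ∧ ∀ k, (_ : k < o) → increasingChoice A k < x}.Nonempty := by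
    obtain ⟨a, ha⟩ := Ordinal.bddAbove_of_small (s := increasingChoice A '' Set.Iio o)
    obtain ⟨b, hb, hab⟩ := hA o (Order.succ a)
    exact ⟨b, hb, fun k hk ↦ (ha ⟨k, hk, rfl⟩).trans_lt (Order.succ_le_iff.1 (not_lt.1 hab))⟩
  have h := csInf_mem hne
  rw [← increasingChoice] at h
  exact h

/-- A family of unbounded classes of ordinals has a strictly increasing choice function. -/
theorem exists_strictMono_forall_mem {A : Ordinal.{u} → Set Ordinal.{u}}
    (hA : ∀ i, Set.Unbounded (· < ·) (A i)) :
    ∃ f : Ordinal.{u} → Ordinal.{u}, StrictMono f ∧ ∀ i, f i ∈ A i :=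
  ⟨increasingChoice A, fun k o hk ↦ (increasingChoice_spec hA o).2 k hk,
    fun o ↦ (increasingChoice_spec hA o).1⟩

/-- Given an Ord-enumeration of proper classes of ordinals in which each class appears
unboundedly often, there are classes `D`, `E` such that each of `C i ∩ (D ∩ E)`,
`C i ∩ (D \ E)` and `C i ∩ (E \ D)` is a proper class for all `i`. -/
theorem exists_two_classes_unbounded_inters
    (C : Ordinal.{u} → Set Ordinal.{u})
    (hC : ∀ i, Set.Unbounded (· < ·) (C i))
    (hrep : ∀ i, Set.Unbounded (· < ·) {j | C j = C i}) :
    ∃ D E : Set Ordinal.{u},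
      ∀ i, Set.Unbounded (· < ·) (C i ∩ (D ∩ E)) ∧
        Set.Unbounded (· < ·) (C i ∩ (D \ E)) ∧
        Set.Unbounded (· < ·) (C i ∩ (E \ D)) := by
  obtain ⟨f, hf, hmem⟩ := exists_strictMono_forall_mem (A := fun j ↦ C (j / 3)) fun j ↦ hC _
  have key (r : Ordinal.{u}) (hr : r < 3) (i a : Ordinal.{u}) :
      ∃ j, j % 3 = r ∧ f j ∈ C i ∧ ¬ f j < a := by
    obtain ⟨j, hj, haj⟩ := hrep i a
    have h3 : (3 : Ordinal.{u}) ≠ 0 := by norm_num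
    refine ⟨3 * j + r, ?_, ?_, not_lt.2 ?_⟩
    · rw [Ordinal.mul_add_mod_self, Ordinal.mod_eq_of_lt hr]
    · have h := hmem (3 * j + r)
      rwa [Ordinal.mul_add_div _ h3, Ordinal.div_eq_zero_of_lt hr, add_zero, hj] at h
    · calc a ≤ j := not_lt.1 haj
        _ ≤ 3 * j := Ordinal.le_mul_right j (pos_iff_ne_zero.2 h3)
        _ ≤ 3 * j + r := le_self_add
        _ ≤ f (3 * j + r) := hf.le_apply
  refine ⟨f '' {j | j % 3 ≠ 2}, f '' {j | j % 3 ≠ 1}, fun i ↦ ⟨fun a ↦ ?_, fun a ↦ ?_, fun a ↦ ?_⟩⟩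
  · obtain ⟨j, hj, hji, haj⟩ := key 0 (by norm_num) i a
    exact ⟨f j, ⟨hji, by simp [hf.injective.mem_set_image, hj]⟩, haj⟩
  · obtain ⟨j, hj, hji, haj⟩ := key 1 (by norm_num) i a
    exact ⟨f j, ⟨hji, by simp [hf.injective.mem_set_image, hj, -Set.mem_image]⟩, haj⟩
  · obtain ⟨j, hj, hji, haj⟩ := key 2 (by norm_num) i a
    exact ⟨f j, ⟨hji, by simp [hf.injective.mem_set_image, hj, -Set.mem_image]⟩, haj⟩
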